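/- For every integer n ≥ 1 and all integers i, j, the number of permutations π of [n] with odes(π) = i and edes(π) = j equals the number of permutations π of [n] with odes(π) = ⌊n/2⌋ − i and edes(π) = ⌊(n−1)/2⌋ − j; equivalently, A_n(p,q) = p^{⌊n/2⌋} q^{⌊(n−1)/2⌋} A_n(1/p, 1/q) for all nonzero real p, q. -/

import Mathlib

/-- `i` (a 1-based index) is a descent of the permutation `π` of `{0,…,n-1}`
(in one-line notation, using 0-based values), i.e. `1 ≤ i ≤ n-1` and `π_i > π_{i+1}`
in the 1-based convention of the paper. -/
def IsDesc {n : ℕ} (π : Equiv.Perm (Fin n)) (i : ℕ) : Prop :=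
  ∃ h : i < n, 0 < i ∧ π ⟨i, h⟩ < π ⟨i - 1, lt_of_le_of_lt (Nat.sub_le i 1) h⟩

instance {n : ℕ} (π : Equiv.Perm (Fin n)) (i : ℕ) : Decidable (IsDesc π i) := by
  unfold IsDesc; infer_instance

/-- the number of odd descents of `π` -/
def odes (n : ℕ) (π : Equiv.Perm (Fin n)) : ℕ :=
  ((Finset.range n).filter fun i => Odd i ∧ IsDesc π i).card

/-- the number of even descents of `π` -/
def edes (n : ℕ) (π : Equiv.Perm (Fin n)) : ℕ :=
  ((Finset.range n).filter fun i => Even i ∧ IsDesc π i).card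

/-- the refined Eulerian polynomial `A_n(p,q)` -/
noncomputable def A (n : ℕ) (p q : ℝ) : ℝ :=
  ∑ π : Equiv.Perm (Fin n), p ^ odes n π * q ^ edes n π

lemma isDesc_compl {n : ℕ} (π : Equiv.Perm (Fin n)) (i : ℕ) (hi : i < n) (h0 : 0 < i) :
    IsDesc (π.trans Fin.revPerm) i ↔ ¬ IsDesc π i := by
  have hne : π ⟨i, hi⟩ ≠ π ⟨i - 1, lt_of_le_of_lt (Nat.sub_le i 1) hi⟩ := by
    intro h
    have := congrArg Fin.val (π.injective h)
    simp only at this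
    omega
  unfold IsDesc
  simp only [Equiv.trans_apply, Fin.revPerm_apply, Fin.rev_lt_rev, hi, h0, exists_true_left,
    true_and, not_lt]
  exact ⟨le_of_lt, fun h => lt_of_le_of_ne h (Ne.symm hne)⟩

lemma card_odd_range (n : ℕ) :
    ((Finset.range n).filter fun i => Odd i ∧ 0 < i).card = n / 2 := by
  induction n with
  | zero => simp
  | succ k ih =>
    rw [Finset.range_add_one, Finset.filter_insert]
    split_ifs with h
    · rw [Finset.card_insert_of_notMem (by simp), ih]
      obtain ⟨⟨m, hm⟩, _⟩ := h
      omega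
    · rw [ih]
      rcases Nat.even_or_odd k with ⟨m, hm⟩ | hk
      · omega
      · exact absurd ⟨hk, hk.pos⟩ h

lemma card_even_range (n : ℕ) :
    ((Finset.range n).filter fun i => Even i ∧ 0 < i).card = (n - 1) / 2 := by
  induction n with
  | zero => simp
  | succ k ih =>
    rw [Finset.range_add_one, Finset.filter_insert]
    split_ifs with h
    · rw [Finset.card_insert_of_notMem (by simp), ih]
      obtain ⟨⟨m, hm⟩, _⟩ := h
      omega
    · rw [ih]
      rcases Nat.even_or_odd k with hk | ⟨m, hm⟩
      · have : ¬ 0 < k := fun h' => h ⟨hk, h'⟩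
        omega
      · omega

lemma card_desc_compl {n : ℕ} (P : ℕ → Prop) [DecidablePred P] (π : Equiv.Perm (Fin n)) :
    ((Finset.range n).filter fun i => P i ∧ IsDesc (π.trans Fin.revPerm) i).card
      + ((Finset.range n).filter fun i => P i ∧ IsDesc π i).card
      = ((Finset.range n).filter fun i => P i ∧ 0 < i).card := by
  rw [← Finset.card_union_of_disjoint]
  · congr 1
    ext i
    simp only [Finset.mem_union, Finset.mem_filter, Finset.mem_range]
    constructor
    · rintro (⟨hi, hP, _, h0, _⟩ | ⟨hi, hP, _, h0, _⟩) <;> exact ⟨hi, hP, h0⟩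
    · rintro ⟨hi, hP, h0⟩
      have := isDesc_compl π i hi h0
      tauto
  · rw [Finset.disjoint_left]
    intro i h1 h2
    simp only [Finset.mem_filter, Finset.mem_range] at h1 h2
    obtain ⟨hi, _, hd⟩ := h1
    have h0 : 0 < i := by
      obtain ⟨_, h0, _⟩ := hd
      exact h0
    exact (isDesc_compl π i hi h0).1 hd h2.2.2

lemma odes_compl {n : ℕ} (π : Equiv.Perm (Fin n)) :
    odes n (π.trans Fin.revPerm) + odes n π = n / 2 := by
  rw [← card_odd_range]
  exact card_desc_compl _ π

lemma edes_compl {n : ℕ} (π : Equiv.Perm (Fin n)) :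
    edes n (π.trans Fin.revPerm) + edes n π = (n - 1) / 2 := by
  rw [← card_even_range]
  exact card_desc_compl _ π

lemma compl_compl_perm {n : ℕ} (π : Equiv.Perm (Fin n)) :
    (π.trans Fin.revPerm).trans Fin.revPerm = π := by
  ext x
  simp

theorem stmt4 (n : ℕ) (hn : 1 ≤ n) (i j : ℤ) (p q : ℝ) (hp : p ≠ 0) (hq : q ≠ 0) :
    (Finset.univ.filter fun π : Equiv.Perm (Fin n) =>
        (odes n π : ℤ) = i ∧ (edes n π : ℤ) = j).card =
      (Finset.univ.filter fun π : Equiv.Perm (Fin n) =>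
        (odes n π : ℤ) = ((n / 2 : ℕ) : ℤ) - i ∧
        (edes n π : ℤ) = (((n - 1) / 2 : ℕ) : ℤ) - j).card ∧
    A n p q = p ^ (n / 2) * q ^ ((n - 1) / 2) * A n (1 / p) (1 / q) := by
  constructor
  · refine Finset.card_bij' (fun π _ => π.trans Fin.revPerm) (fun π _ => π.trans Fin.revPerm)
      ?_ ?_ ?_ ?_
    · intro π h
      have h1 := odes_compl π
      have h2 := edes_compl π
      simp only [Finset.mem_filter, Finset.mem_univ, true_and] at h ⊢
      omega
    · intro π h
      have h1 := odes_compl π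
      have h2 := edes_compl π
      simp only [Finset.mem_filter, Finset.mem_univ, true_and] at h ⊢
      omega
    · intro π _
      exact compl_compl_perm π
    · intro π _
      exact compl_compl_perm π
  · unfold A
    rw [Finset.mul_sum]
    refine Finset.sum_bij' (fun π _ => π.trans Fin.revPerm) (fun π _ => π.trans Fin.revPerm)
      (fun _ _ => Finset.mem_univ _) (fun _ _ => Finset.mem_univ _)
      (fun π _ => compl_compl_perm π) (fun π _ => compl_compl_perm π) ?_
    intro π _
    rw [← odes_compl π, ← edes_compl π, pow_add, pow_add, one_div, one_div, inv_pow, inv_pow]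
    field_simp
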